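/- arXiv:2306.03041 — 6 statements merged into one kernel-verified Lean document; each statement's English description precedes it below -/
import Mathlib

section
/- Let λ, μ, η be real numbers with λ ≥ 0 and η ≥ 0. Then the quadratic constraint 1 + λ·η ≤ μ·η holds if and only if λ < μ and 1/(μ − λ) ≤ η. -/
theorem stmt_0 (lam mu eta : ℝ) (hlam : 0 ≤ lam) (heta : 0 ≤ eta) :
    1 + lam * eta ≤ mu * eta ↔ lam < mu ∧ 1 / (mu - lam) ≤ eta := by
  constructor
  · intro h
    have hlt : lam < mu := by
      by_contra! hle
      linarith [mul_le_mul_of_nonneg_right hle heta]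
    refine ⟨hlt, ?_⟩
    rw [div_le_iff₀ (sub_pos.mpr hlt)]
    linarith
  · rintro ⟨hlt, h⟩
    rw [div_le_iff₀ (sub_pos.mpr hlt)] at h
    linarith
end

section
/- Let n be a natural number, let λ, μ, z : Fin n → ℝ satisfy λ i ≥ 0 and z i ≥ 0 for all i, and let d be a real number. Then the following are equivalent: (i) there exists η : Fin n → ℝ such that for every i one has 0 ≤ η i and 1 + (λ i)·(η i) ≤ (μ i)·(η i), and ∑ i, (z i)·(η i) ≤ d; (ii) for every i one has λ i < μ i, and ∑ i, (z i)/(μ i − λ i) ≤ d. -/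
theorem stmt_2 (n : ℕ) (lam mu z : Fin n → ℝ)
    (hlam : ∀ i, 0 ≤ lam i) (hz : ∀ i, 0 ≤ z i) (d : ℝ) :
    (∃ eta : Fin n → ℝ,
        (∀ i, 0 ≤ eta i ∧ 1 + lam i * eta i ≤ mu i * eta i) ∧
        ∑ i, z i * eta i ≤ d) ↔
    ((∀ i, lam i < mu i) ∧ ∑ i, z i / (mu i - lam i) ≤ d) := by
  constructor
  · rintro ⟨eta, heta, hd⟩
    have hlt : ∀ i, lam i < mu i := fun i ↦ by
      by_contra! h
      linarith [mul_le_mul_of_nonneg_right h (heta i).1, (heta i).2]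
    refine ⟨hlt, (Finset.sum_le_sum fun i _ ↦ ?_).trans hd⟩
    rw [div_le_iff₀ (sub_pos.2 (hlt i)), mul_assoc]
    exact le_mul_of_one_le_right (hz i) (by linarith [(heta i).2])
  · rintro ⟨hlt, hd⟩
    refine ⟨fun i ↦ (mu i - lam i)⁻¹, fun i ↦ ⟨inv_nonneg.2 (sub_pos.2 (hlt i)).le, ?_⟩, ?_⟩
    · have h : (mu i - lam i) * (mu i - lam i)⁻¹ = 1 := mul_inv_cancel₀ (sub_pos.2 (hlt i)).ne'
      linarith
    · simpa only [div_eq_mul_inv] using hd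
end

section
/- Let a, b, x be real numbers with 0 < a ≤ x ≤ b. Then (a + b − x)/(a·b) − 1/x ≤ (√b − √a)²/(a·b); that is, the error of the secant approximation of g(x) = 1/x on [a, b] is at most (√b − √a)²/(a·b). -/
theorem stmt_4 (a b x : ℝ) (ha : 0 < a) (hax : a ≤ x) (hxb : x ≤ b) :
    (a + b - x) / (a * b) - 1 / x ≤ (Real.sqrt b - Real.sqrt a) ^ 2 / (a * b) := by
  have hx : 0 < x := ha.trans_le hax
  have hb : 0 < b := hx.trans_le hxb
  obtain ⟨s, hs, rfl⟩ : ∃ s : ℝ, 0 < s ∧ s ^ 2 = a := ⟨√a, Real.sqrt_pos.2 ha, Real.sq_sqrt ha.le⟩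
  obtain ⟨t, ht, rfl⟩ : ∃ t : ℝ, 0 < t ∧ t ^ 2 = b := ⟨√b, Real.sqrt_pos.2 hb, Real.sq_sqrt hb.le⟩
  rw [Real.sqrt_sq hs.le, Real.sqrt_sq ht.le, ← sub_nonneg]
  have key : (t - s) ^ 2 / (s ^ 2 * t ^ 2) - ((s ^ 2 + t ^ 2 - x) / (s ^ 2 * t ^ 2) - 1 / x)
      = (x - s * t) ^ 2 / (s ^ 2 * t ^ 2 * x) := by
    field_simp
    ring
  rw [key]
  positivity
end

section
/- Let ε, E be real numbers with 0 < ε ≤ E. Then the set Ω = { w ∈ ℝ × ℝ | ∃ α ∈ [0,1], ∃ x ∈ [ε, E], ∃ y ∈ [0,1], w = (α·x, α·y) } is equal to the set { (u, v) ∈ ℝ × ℝ | 0 ≤ v ∧ v ≤ 1 ∧ v·ε ≤ u ∧ u ≤ E }. -/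
theorem stmt_8 (ε E : ℝ) (hε : 0 < ε) (hεE : ε ≤ E) :
    {w : ℝ × ℝ | ∃ α ∈ Set.Icc (0 : ℝ) 1, ∃ x ∈ Set.Icc ε E, ∃ y ∈ Set.Icc (0 : ℝ) 1,
        w = (α * x, α * y)} =
    {w : ℝ × ℝ | 0 ≤ w.2 ∧ w.2 ≤ 1 ∧ w.2 * ε ≤ w.1 ∧ w.1 ≤ E} := by
  ext ⟨u, v⟩
  simp only [Set.mem_ofPred_eq, Set.mem_Icc, Prod.mk.injEq]
  constructor
  · rintro ⟨α, ⟨hα0, hα1⟩, x, ⟨hεx, hxE⟩, y, ⟨hy0, hy1⟩, rfl, rfl⟩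
    refine ⟨mul_nonneg hα0 hy0, mul_le_one₀ hα1 hy0 hy1, ?_, ?_⟩
    · rw [mul_assoc]
      exact mul_le_mul_of_nonneg_left ((mul_le_of_le_one_left hε.le hy1).trans hεx) hα0
    · exact (mul_le_of_le_one_left (hε.le.trans hεx) hα1).trans hxE
  · rintro ⟨hv0, hv1, hvu, huE⟩
    rcases le_or_gt ε u with hu | hu
    · exact ⟨1, ⟨zero_le_one, le_rfl⟩, u, ⟨hu, huE⟩, v, ⟨hv0, hv1⟩, by simp, by simp⟩
    · have hu0 : 0 ≤ u := (mul_nonneg hv0 hε.le).trans hvu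
      refine ⟨u / ε, ⟨by positivity, (div_le_one hε).2 hu.le⟩, ε, ⟨le_rfl, hεE⟩,
        v * ε / u, ⟨by positivity, div_le_one_of_le₀ hvu hu0⟩, by field_simp, ?_⟩
      rcases hu0.eq_or_lt with rfl | hu_pos
      · have hv : v = 0 := le_antisymm (nonpos_of_mul_nonpos_left hvu hε) hv0
        simp [hv]
      · field_simp
end

section
/- Let K ≥ 1 be a natural number and let π : Fin (K+1) → ℝ be strictly monotone increasing with π 0 > 0. Let (u, v) ∈ ℝ × ℝ satisfy 0 ≤ v ≤ 1 and v·(π 0) ≤ u ≤ π K. Then at least one of the following holds: (i) there exist an index k with k + 1 ≤ K and reals ξ, ξ' ≥ 0 with ξ + ξ' ≤ 1 such that u = ξ·(π k) + ξ'·(π (k+1)) and v = ξ + ξ'; or (ii) there exist reals ξ, ξ' ≥ 0 with ξ + ξ' ≤ 1 such that u = (ξ + ξ')·(π K) and v = ξ. -/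
/-- If `f` starts at or below `u` and exceeds `u` at index `n`, then it crosses `u` between two
consecutive indices. -/
theorem exists_le_lt_succ_of_le_of_lt {α : Type*} [LinearOrder α] {N : ℕ} (f : Fin (N + 1) → α)
    {u : α} (h0 : f ⟨0, N.succ_pos⟩ ≤ u) (n : ℕ) (hn : n < N + 1) (hu : u < f ⟨n, hn⟩) :
    ∃ k : ℕ, ∃ hk : k + 1 ≤ N, f ⟨k, by omega⟩ ≤ u ∧ u < f ⟨k + 1, by omega⟩ := by
  induction n with
  | zero => exact absurd hu h0.not_gt
  | succ m ih =>
    rcases le_or_gt (f ⟨m, by omega⟩) u with h | h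
    · exact ⟨m, by omega, h, hu⟩
    · exact ih (by omega) h

/-- A point between `v * a` and `v * b` is a combination of `a` and `b` with total weight `v`. -/
theorem exists_nonneg_weights {a b u v : ℝ} (hab : a < b) (ha : v * a ≤ u) (hb : u ≤ v * b) :
    ∃ ξ ξ' : ℝ, 0 ≤ ξ ∧ 0 ≤ ξ' ∧ u = ξ * a + ξ' * b ∧ v = ξ + ξ' := by
  have hd : 0 < b - a := sub_pos.mpr hab
  refine ⟨(v * b - u) / (b - a), (u - v * a) / (b - a), div_nonneg (by linarith) hd.le,
    div_nonneg (by linarith) hd.le, ?_, ?_⟩ <;> field_simp <;> ring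


theorem stmt_9 (K : ℕ) (hK : 1 ≤ K) (p : Fin (K + 1) → ℝ) (hp : StrictMono p)
    (hp0 : 0 < p ⟨0, Nat.succ_pos K⟩) (u v : ℝ)
    (hv0 : 0 ≤ v) (hv1 : v ≤ 1)
    (hu0 : v * p ⟨0, Nat.succ_pos K⟩ ≤ u) (huK : u ≤ p ⟨K, Nat.lt_succ_self K⟩) :
    (∃ k : ℕ, ∃ hk : k + 1 ≤ K, ∃ ξ ξ' : ℝ, 0 ≤ ξ ∧ 0 ≤ ξ' ∧ ξ + ξ' ≤ 1 ∧
        u = ξ * p ⟨k, by omega⟩ + ξ' * p ⟨k + 1, by omega⟩ ∧ v = ξ + ξ') ∨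
    (∃ ξ ξ' : ℝ, 0 ≤ ξ ∧ 0 ≤ ξ' ∧ ξ + ξ' ≤ 1 ∧
        u = (ξ + ξ') * p ⟨K, Nat.lt_succ_self K⟩ ∧ v = ξ) := by
  have hpK : 0 < p ⟨K, Nat.lt_succ_self K⟩ :=
    hp0.trans_le (hp.monotone (Fin.mk_le_mk.mpr (Nat.zero_le K)))
  rcases le_or_gt (v * p ⟨K, Nat.lt_succ_self K⟩) u with h | h
  · refine Or.inr ⟨v, u / p ⟨K, Nat.lt_succ_self K⟩ - v, hv0, ?_, ?_, ?_, rfl⟩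
    · exact sub_nonneg.mpr ((le_div_iff₀ hpK).mpr h)
    · rw [add_sub_cancel]
      exact (div_le_one hpK).mpr huK
    · rw [add_sub_cancel, div_mul_cancel₀ _ hpK.ne']
  · obtain ⟨k, hk, hle, hlt⟩ :=
      exists_le_lt_succ_of_le_of_lt (fun i => v * p i) hu0 K (Nat.lt_succ_self K) h
    obtain ⟨ξ, ξ', hξ, hξ', hu, hv⟩ :=
      exists_nonneg_weights (hp (Fin.mk_lt_mk.mpr k.lt_succ_self)) hle hlt.le
    exact Or.inl ⟨k, hk, ξ, ξ', hξ, hξ', hv ▸ hv1, hu, hv⟩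
end

section
/- Let K ≥ 1 be a natural number and let π : Fin (K+1) → ℝ be strictly monotone increasing with π 0 > 0. Then for every real x with π 0 ≤ x ≤ π K there exists an index k with k + 1 ≤ K such that π k ≤ x ≤ π (k+1) and 0 ≤ (π k + π (k+1) − x)/((π k)·(π (k+1))) − 1/x ≤ (√(π (k+1)) − √(π k))² / ((π k)·(π (k+1))); in particular, the piecewise-linear secant interpolant of g(x) = 1/x over the partition overestimates g everywhere on [π 0, π K] with pointwise error at most the maximum of (√(π (k+1)) − √(π k))²/((π k)·(π (k+1))) over the subintervals. -/
theorem exists_consecutive_le_le {α : Type*} [LinearOrder α] {K : ℕ} (hK : 1 ≤ K)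
    (q : ℕ → α) {x : α} (h0 : q 0 ≤ x) (hx : x ≤ q K) :
    ∃ k, k + 1 ≤ K ∧ q k ≤ x ∧ x ≤ q (k + 1) := by
  induction K, hK using Nat.le_induction with
  | base => exact ⟨0, le_rfl, h0, hx⟩
  | succ n _ ih =>
    rcases le_total x (q n) with h | h
    · obtain ⟨k, hk, hkx⟩ := ih h
      exact ⟨k, by omega, hkx⟩
    · exact ⟨n, le_rfl, h, hx⟩

theorem secant_sub_one_div_eq {a b x : ℝ} (ha : a ≠ 0) (hb : b ≠ 0) (hx : x ≠ 0) :
    (a + b - x) / (a * b) - 1 / x = (x - a) * (b - x) / x / (a * b) := by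
  field_simp
  ring

theorem secant_sub_one_div_nonneg {a b x : ℝ} (ha : 0 < a) (hax : a ≤ x) (hxb : x ≤ b) :
    0 ≤ (a + b - x) / (a * b) - 1 / x := by
  have hx := ha.trans_le hax
  have hb := hx.trans_le hxb
  rw [secant_sub_one_div_eq ha.ne' hb.ne' hx.ne']
  have := sub_nonneg.2 hax
  have := sub_nonneg.2 hxb
  positivity

theorem secant_sub_one_div_le {a b x : ℝ} (ha : 0 < a) (hb : 0 < b) (hx : 0 < x) :
    (a + b - x) / (a * b) - 1 / x ≤ (√b - √a) ^ 2 / (a * b) := by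
  rw [secant_sub_one_div_eq ha.ne' hb.ne' hx.ne']
  gcongr
  rw [div_le_iff₀ hx]
  obtain ⟨s, hs, rfl⟩ : ∃ s, 0 ≤ s ∧ a = s ^ 2 := ⟨√a, Real.sqrt_nonneg a, (Real.sq_sqrt ha.le).symm⟩
  obtain ⟨t, ht, rfl⟩ : ∃ t, 0 ≤ t ∧ b = t ^ 2 := ⟨√b, Real.sqrt_nonneg b, (Real.sq_sqrt hb.le).symm⟩
  rw [Real.sqrt_sq hs, Real.sqrt_sq ht]
  linarith [sq_nonneg (x - s * t)]

theorem stmt_10 (K : ℕ) (hK : 1 ≤ K) (p : Fin (K + 1) → ℝ) (hp : StrictMono p)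
    (hp0 : 0 < p ⟨0, Nat.succ_pos K⟩)
    (x : ℝ) (hx0 : p ⟨0, Nat.succ_pos K⟩ ≤ x) (hxK : x ≤ p ⟨K, Nat.lt_succ_self K⟩) :
    ∃ k : ℕ, ∃ hk : k + 1 ≤ K,
      p ⟨k, by omega⟩ ≤ x ∧ x ≤ p ⟨k + 1, by omega⟩ ∧
      0 ≤ (p ⟨k, by omega⟩ + p ⟨k + 1, by omega⟩ - x) / (p ⟨k, by omega⟩ * p ⟨k + 1, by omega⟩)
          - 1 / x ∧
      (p ⟨k, by omega⟩ + p ⟨k + 1, by omega⟩ - x) / (p ⟨k, by omega⟩ * p ⟨k + 1, by omega⟩)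
          - 1 / x ≤
        (Real.sqrt (p ⟨k + 1, by omega⟩) - Real.sqrt (p ⟨k, by omega⟩)) ^ 2 /
          (p ⟨k, by omega⟩ * p ⟨k + 1, by omega⟩) := by
  obtain ⟨k, hk, hkx, hxk⟩ := exists_consecutive_le_le hK
    (fun n => p ⟨min n K, by omega⟩) (x := x) (by simpa using hx0) (by simpa using hxK)
  simp only [min_eq_left hk, min_eq_left (show k ≤ K by omega)] at hkx hxk
  have ha : 0 < p ⟨k, by omega⟩ := hp0.trans_le (hp.monotone (Fin.mk_le_mk.2 k.zero_le))
  have hx := ha.trans_le hkx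
  exact ⟨k, hk, hkx, hxk, secant_sub_one_div_nonneg ha hkx hxk,
    secant_sub_one_div_le ha (hx.trans_le hxk) hx⟩
end
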